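/- Let B_h be a bisector and let G = ℙ(W₀) be a geodesic with G ⊆ B_h. Then G is contained in a complex projective line that is contained in B_h (a slice of B_h), or G is contained in an ℝ-plane that is contained in B_h (a meridian of B_h). -/

import Mathlib

open scoped ComplexConjugate

noncomputable section

/-- `V` is `ℂ³`. -/
abbrev V3 : Type := Fin 3 → ℂ

/-- The hermitian form of signature `(2,1)`:
`⟨x,y⟩ = x₀·conj y₀ + x₁·conj y₁ − x₂·conj y₂`. -/
def herm (x y : V3) : ℂ := x 0 * conj (y 0) + x 1 * conj (y 1) - x 2 * conj (y 2)

/-- The complex projective plane `ℙ(V)`. -/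
abbrev PV : Type := Projectivization ℂ V3

/-- The class `[v]` of a nonzero vector `v` in `ℙ(V)`. -/
def projMk (v : V3) (hv : v ≠ 0) : PV := Projectivization.mk ℂ v hv

/-- A map `h` is self-adjoint (`h* = h`) w.r.t. the hermitian form. -/
def SelfAdj (h : Module.End ℂ V3) : Prop := ∀ x y : V3, herm (h x) y = herm x (h y)

/-- The set `B_h = {[v] ∈ ℙ(V) | ⟨h v, v⟩ = 0}`. -/
def Bset (h : Module.End ℂ V3) : Set PV :=
  {q | ∃ v : V3, ∃ hv : v ≠ 0, q = projMk v hv ∧ herm (h v) v = 0}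

/-- `h` defines a bisector: self-adjoint, trace `0`, rank `2`, and `B_h` contains
a point other than the focus (i.e. a point `[v]` with `h v ≠ 0`). -/
def IsBisector (h : Module.End ℂ V3) : Prop :=
  SelfAdj h ∧ LinearMap.trace ℂ V3 h = 0 ∧
    Module.finrank ℂ (LinearMap.range h) = 2 ∧ ∃ v : V3, herm (h v) v = 0 ∧ h v ≠ 0

/-- A linear family of bisectors: an `ℝ`-subspace of self-adjoint traceless
degenerate maps whose base contains a negative point. -/
def IsLinearFamily (W : Submodule ℝ (Module.End ℂ V3)) : Prop :=
  (∀ h ∈ W, SelfAdj h ∧ LinearMap.trace ℂ V3 h = 0 ∧ LinearMap.det h = 0) ∧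
    ∃ v : V3, ∃ hv : v ≠ 0, (herm v v).re < 0 ∧ ∀ h ∈ W, herm (h v) v = 0

/-- The map `x ↦ ⟨x,p⟩·p`. -/
def wmap (p : V3) : Module.End ℂ V3 where
  toFun x := herm x p • p
  map_add' x y := by
    show herm (x + y) p • p = herm x p • p + herm y p • p
    have : herm (x + y) p = herm x p + herm y p := by
      simp only [herm, Pi.add_apply]; ring
    rw [this, add_smul]
  map_smul' c x := by
    show herm (c • x) p • p = c • (herm x p • p)
    have : herm (c • x) p = c * herm x p := by
      simp only [herm, Pi.smul_apply, smul_eq_mul]; ring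
    rw [this, mul_smul]

/-- `ℙ(U)` for a complex subspace `U`. -/
def projC (U : Submodule ℂ V3) : Set PV :=
  {q | ∃ v : V3, ∃ hv : v ≠ 0, v ∈ U ∧ q = projMk v hv}

/-- `ℙ(T)` for a real subspace `T`. -/
def projR (T : Submodule ℝ V3) : Set PV :=
  {q | ∃ v : V3, ∃ hv : v ≠ 0, v ∈ T ∧ q = projMk v hv}

/-- An `ℝ`-plane: `ℙ(T)` for a totally real `3`-dimensional real subspace `T`
with `ℂ·T = V`. -/
def IsRealPlane (T : Submodule ℝ V3) : Prop :=
  Module.finrank ℝ T = 3 ∧ Submodule.span ℂ (T : Set V3) = ⊤ ∧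
    ∀ t ∈ T, ∀ t' ∈ T, (herm t t').im = 0

/-- A geodesic: `ℙ(W₀)` for a `2`-dimensional real subspace `W₀` on which the form
is real-valued and not identically zero. -/
def IsGeodesic (W₀ : Submodule ℝ V3) : Prop :=
  Module.finrank ℝ W₀ = 2 ∧ (∀ w ∈ W₀, ∀ w' ∈ W₀, (herm w w').im = 0) ∧
    ∃ w ∈ W₀, ∃ w' ∈ W₀, herm w w' ≠ 0

/-- The real spine `R = {[h v] | [v] ∈ B_h, h v ≠ 0}` of `B_h`. -/
def RealSpine (h : Module.End ℂ V3) : Set PV :=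
  {q | ∃ v : V3, ∃ hnz : h v ≠ 0, herm (h v) v = 0 ∧ q = projMk (h v) hnz}

/-- The orthogonal complement w.r.t. the hermitian form. -/
def hermOrth (U : Submodule ℂ V3) : Submodule ℂ V3 where
  carrier := {x | ∀ u ∈ U, herm x u = 0}
  add_mem' := by
    intro a b ha hb u hu
    have h1 : herm (a + b) u = herm a u + herm b u := by
      simp only [herm, Pi.add_apply]; ring
    rw [h1, ha u hu, hb u hu, add_zero]
  zero_mem' := by
    intro u hu
    simp [herm]
  smul_mem' := by
    intro c x hx u hu
    have h1 : herm (c • x) u = c * herm x u := by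
      simp only [herm, Pi.smul_apply, smul_eq_mul]; ring
    rw [h1, hx u hu, mul_zero]


section HermitianForm

theorem herm_add_left (x y z : V3) : herm (x + y) z = herm x z + herm y z := by
  simp only [herm, Pi.add_apply]; ring

theorem herm_smul_left (c : ℂ) (x z : V3) : herm (c • x) z = c * herm x z := by
  simp only [herm, Pi.smul_apply, smul_eq_mul]; ring

theorem herm_conj (x y : V3) : conj (herm x y) = herm y x := by
  simp only [herm, map_add, map_sub, map_mul, Complex.conj_conj]; ring

theorem herm_add_right (x y z : V3) : herm z (x + y) = herm z x + herm z y := by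
  simp only [herm, Pi.add_apply, map_add]; ring

theorem herm_smul_right (c : ℂ) (x z : V3) : herm z (c • x) = conj c * herm z x := by
  simp only [herm, Pi.smul_apply, smul_eq_mul, map_mul]; ring

theorem herm_zero_left (z : V3) : herm 0 z = 0 := by simp [herm]

theorem herm_self_im (x : V3) : (herm x x).im = 0 :=
  Complex.conj_eq_iff_im.mp (herm_conj x x)

theorem SelfAdj.conj_herm {h : Module.End ℂ V3} (hs : SelfAdj h) (x y : V3) :
    conj (herm (h x) y) = herm (h y) x := by
  rw [herm_conj, hs]

theorem SelfAdj.herm_self_im {h : Module.End ℂ V3} (hs : SelfAdj h) (x : V3) :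
    (herm (h x) x).im = 0 :=
  Complex.conj_eq_iff_im.mp (hs.conj_herm x x)

theorem SelfAdj.re_comm {h : Module.End ℂ V3} (hs : SelfAdj h) (x y : V3) :
    (herm (h x) y).re = (herm (h y) x).re := by
  rw [← hs.conj_herm x y, Complex.conj_re]

theorem herm_im_comm (x y : V3) : (herm x y).im = -(herm y x).im := by
  rw [← herm_conj y x, Complex.conj_im]

end HermitianForm

theorem real_smul_eq_coe_smul (r : ℝ) (x : V3) : r • x = (r : ℂ) • x := by
  ext i; simp

/-- The quadratic form of `h` vanishes at every representative of a point of `B_h`. -/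
theorem herm_eq_zero_of_mem_Bset {h : Module.End ℂ V3} {v : V3} (hv : v ≠ 0)
    (hm : projMk v hv ∈ Bset h) : herm (h v) v = 0 := by
  obtain ⟨w, hw, he, hz⟩ := hm
  obtain ⟨a, rfl⟩ := (Projectivization.mk_eq_mk_iff' ℂ v w hv hw).mp he
  rw [map_smul, herm_smul_left, herm_smul_right, hz]; simp

/-- The real span of a complex basis with real Gram matrix on which the form of `h` is purely
imaginary is an `ℝ`-plane contained in `B_h`. -/
theorem isRealPlane_span_and_subset {h : Module.End ℂ V3} (hs : SelfAdj h) {x y z : V3}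
    (hli : LinearIndependent ℂ ![x, y, z])
    (hxy : (herm x y).im = 0) (hxz : (herm x z).im = 0) (hyz : (herm y z).im = 0)
    (kx : (herm (h x) x).re = 0) (ky : (herm (h y) y).re = 0) (kz : (herm (h z) z).re = 0)
    (kxy : (herm (h x) y).re = 0) (kxz : (herm (h x) z).re = 0) (kyz : (herm (h y) z).re = 0) :
    IsRealPlane (Submodule.span ℝ {x, y, z}) ∧
      projR (Submodule.span ℝ {x, y, z}) ⊆ Bset h := by
  have hr : Set.range ![x, y, z] = {x, y, z} := by
    simp only [Matrix.range_cons, Matrix.range_empty, Set.union_empty]; rfl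
  refine ⟨⟨?_, ?_, ?_⟩, ?_⟩
  · have hl : LinearIndependent ℝ ![x, y, z] := hli.restrict_scalars' ℝ
    have := finrank_span_eq_card hl
    rwa [hr, Fintype.card_fin] at this
  · rw [Submodule.span_span_of_tower, ← hr]
    exact hli.span_eq_top_of_card_eq_finrank' (by simp)
  · intro t ht t' ht'
    obtain ⟨a, b, c, rfl⟩ := Submodule.mem_span_triple.mp ht
    obtain ⟨a', b', c', rfl⟩ := Submodule.mem_span_triple.mp ht'
    have hyx := herm_im_comm y x
    have hzx := herm_im_comm z x
    have hzy := herm_im_comm z y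
    simp only [real_smul_eq_coe_smul, herm_add_left, herm_add_right, herm_smul_left,
      herm_smul_right]
    simp [hxy, hxz, hyz, hyx, hzx, hzy, herm_self_im]
  · rintro _ ⟨t, ht0, ht, rfl⟩
    refine ⟨t, ht0, rfl, ?_⟩
    refine Complex.ext ?_ (hs.herm_self_im t)
    obtain ⟨a, b, c, rfl⟩ := Submodule.mem_span_triple.mp ht
    have kyx := hs.re_comm y x
    have kzx := hs.re_comm z x
    have kzy := hs.re_comm z y
    simp only [real_smul_eq_coe_smul, map_add, map_smul, herm_add_left, herm_add_right,
      herm_smul_left, herm_smul_right]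
    simp [kx, ky, kz, kxy, kxz, kyz, kyx, kzx, kzy]

/-- The complex line through two points of `B_h` orthogonal for the form of `h` is a slice. -/
theorem projC_span_pair_subset {h : Module.End ℂ V3} {x y : V3} (hs : SelfAdj h)
    (kx : herm (h x) x = 0) (ky : herm (h y) y = 0) (kxy : herm (h x) y = 0) :
    projC (Submodule.span ℂ {x, y}) ⊆ Bset h := by
  rintro _ ⟨t, ht0, ht, rfl⟩
  refine ⟨t, ht0, rfl, ?_⟩
  obtain ⟨a, b, rfl⟩ := Submodule.mem_span_pair.mp ht
  have kyx : herm (h y) x = 0 := by rw [← hs.conj_herm, kxy, map_zero]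
  simp [herm_add_left, herm_add_right, herm_smul_left, herm_smul_right, kx, ky, kxy, kyx]

theorem det_eq_zero_of_finrank_range {h : Module.End ℂ V3}
    (hr : Module.finrank ℂ (LinearMap.range h) = 2) : LinearMap.det h = 0 := by
  by_contra hd
  have := (LinearMap.isUnit_iff_range_eq_top h).mp
    ((LinearMap.isUnit_iff_isUnit_det h).mpr (isUnit_iff_ne_zero.mpr hd))
  rw [this, finrank_top] at hr
  simp at hr

/-- The matrix of an endomorphism in a basis given by three vectors. -/
theorem exists_matrix_of_linearIndependent {h : Module.End ℂ V3} {x y z : V3}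
    (hli : LinearIndependent ℂ ![x, y, z]) :
    ∃ M : Matrix (Fin 3) (Fin 3) ℂ,
      h x = M 0 0 • x + M 1 0 • y + M 2 0 • z ∧
      h y = M 0 1 • x + M 1 1 • y + M 2 1 • z ∧
      h z = M 0 2 • x + M 1 2 • y + M 2 2 • z ∧
      LinearMap.trace ℂ V3 h = M.trace ∧ LinearMap.det h = M.det := by
  let b := basisOfLinearIndependentOfCardEqFinrank hli (by simp)
  have hb : ⇑b = ![x, y, z] := coe_basisOfLinearIndependentOfCardEqFinrank hli (by simp)
  have key (j : Fin 3) : h (b j) = ∑ i, LinearMap.toMatrix b b h i j • b i := by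
    simp only [LinearMap.toMatrix_apply]
    exact (b.sum_repr _).symm
  refine ⟨LinearMap.toMatrix b b h, ?_, ?_, ?_, LinearMap.trace_eq_matrix_trace ℂ b h,
    (LinearMap.det_toMatrix b h).symm⟩
  · simpa [hb, Fin.sum_univ_three] using key 0
  · simpa [hb, Fin.sum_univ_three] using key 1
  · simpa [hb, Fin.sum_univ_three] using key 2

/-- Pairwise orthogonal non-null vectors are independent. -/
theorem linearIndependent_triple_of_orthogonal {x y z : V3}
    (hx : herm x x ≠ 0) (hy : herm y y ≠ 0) (hz : herm z z ≠ 0)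
    (hxy : herm x y = 0) (hxz : herm x z = 0) (hyz : herm y z = 0) :
    LinearIndependent ℂ ![x, y, z] := by
  have hyx : herm y x = 0 := by rw [← herm_conj, hxy, map_zero]
  have hzx : herm z x = 0 := by rw [← herm_conj, hxz, map_zero]
  have hzy : herm z y = 0 := by rw [← herm_conj, hyz, map_zero]
  rw [Fintype.linearIndependent_iff]
  intro g hg
  simp only [Fin.sum_univ_three, Matrix.cons_val] at hg
  have e (v : V3) := congrArg (herm · v) hg
  simp only [herm_add_left, herm_smul_left, herm_zero_left] at e
  have ex := e x
  have ey := e y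
  have ez := e z
  simp only [hxy, hxz, hyz, hyx, hzx, hzy, mul_zero, add_zero, zero_add, mul_eq_zero, hx, hy, hz,
    or_false] at ex ey ez
  intro i
  fin_cases i <;> assumption

/-- A hyperbolic pair and a non-null vector orthogonal to it are independent. -/
theorem linearIndependent_triple_of_hyperbolic {n w m : V3}
    (hw : herm w w ≠ 0) (hnn : herm n n = 0) (hmm : herm m m = 0)
    (hnw : herm n w = 0) (hmw : herm m w = 0) (hnm : herm n m = 1) :
    LinearIndependent ℂ ![n, w, m] := by
  have hwn : herm w n = 0 := by rw [← herm_conj, hnw, map_zero]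
  have hwm : herm w m = 0 := by rw [← herm_conj, hmw, map_zero]
  have hmn : herm m n = 1 := by rw [← herm_conj, hnm, map_one]
  rw [Fintype.linearIndependent_iff]
  intro g hg
  simp only [Fin.sum_univ_three, Matrix.cons_val] at hg
  have e (v : V3) := congrArg (herm · v) hg
  simp only [herm_add_left, herm_smul_left, herm_zero_left] at e
  have en := e n
  have ew := e w
  have em := e m
  simp only [hnn, hmm, hnw, hmw, hnm, hwn, hwm, hmn, mul_zero, mul_one, add_zero, zero_add,
    mul_eq_zero, hw, or_false] at en ew em
  intro i
  fin_cases i <;> assumption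

/-- The polar vector of a nondegenerate orthogonal pair. -/
theorem exists_polar {x y : V3} (hx : herm x x ≠ 0) (hy : herm y y ≠ 0) (hxy : herm x y = 0) :
    ∃ p : V3, herm x p = 0 ∧ herm y p = 0 ∧ herm p p ≠ 0 := by
  refine ⟨![conj (x 1 * y 2 - x 2 * y 1), conj (x 2 * y 0 - x 0 * y 2),
    -conj (x 0 * y 1 - x 1 * y 0)], ?_, ?_, ?_⟩
  · simp [herm]; ring
  · simp [herm]; ring
  · have hyx : herm y x = 0 := by rw [← herm_conj, hxy, map_zero]
    have : herm x x * herm y y ≠ 0 := mul_ne_zero hx hy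
    intro h0
    apply this
    have e : herm x x * herm y y - herm x y * herm y x = 0 := by
      rw [← neg_eq_zero, ← h0]
      simp [herm]; ring
    rwa [hxy, zero_mul, sub_zero] at e

/-- A null vector orthogonal to a non-null vector `w` has a null partner orthogonal to `w`. -/
theorem exists_hyperbolic_partner {n w : V3} (hn : n ≠ 0) (hw : herm w w ≠ 0)
    (hnn : herm n n = 0) (hnw : herm n w = 0) :
    ∃ m : V3, herm m m = 0 ∧ herm m w = 0 ∧ herm n m = 1 := by
  have hwn : herm w n = 0 := by rw [← herm_conj, hnw, map_zero]
  have h0 : herm ![n 0, n 1, -n 2] n ≠ 0 := by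
    intro h0
    apply hn
    have e : Complex.normSq (n 0) + Complex.normSq (n 1) + Complex.normSq (n 2) = 0 := by
      have : ((Complex.normSq (n 0) + Complex.normSq (n 1) + Complex.normSq (n 2) : ℝ) : ℂ)
          = 0 := by
        push_cast
        rw [← h0]
        simp [herm, Complex.normSq_eq_conj_mul_self]; ring
      exact_mod_cast this
    have p0 := Complex.normSq_nonneg (n 0)
    have p1 := Complex.normSq_nonneg (n 1)
    have p2 := Complex.normSq_nonneg (n 2)
    have z0 : n 0 = 0 := Complex.normSq_eq_zero.mp (by linarith)
    have z1 : n 1 = 0 := Complex.normSq_eq_zero.mp (by linarith)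
    have z2 : n 2 = 0 := Complex.normSq_eq_zero.mp (by linarith)
    ext i
    fin_cases i <;> assumption
  set v : V3 := ![n 0, n 1, -n 2]
  obtain ⟨m, hmw, hmn⟩ : ∃ m : V3, herm m w = 0 ∧ herm m n = 1 := by
    refine ⟨(herm v n)⁻¹ • (v + (-(herm v w / herm w w)) • w), ?_, ?_⟩
    · rw [herm_smul_left, herm_add_left, herm_smul_left]
      field_simp; ring
    · rw [herm_smul_left, herm_add_left, herm_smul_left, hwn]
      field_simp; ring
  have hnm : herm n m = 1 := by rw [← herm_conj, hmn, map_one]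
  have hmm : conj (herm m m) = herm m m := herm_conj m m
  refine ⟨m + (-(herm m m / 2)) • n, ?_, ?_, ?_⟩
  · simp only [herm_add_left, herm_add_right, herm_smul_left, herm_smul_right, hnm, hmn, hnn,
      map_neg, map_div₀, hmm, map_ofNat]
    ring
  · simp only [herm_add_left, herm_smul_left, hmw, hnw, mul_zero, add_zero]
  · simp only [herm_add_right, herm_smul_right, hnm, hnn, mul_zero, add_zero]

/-- A complex number rotating two `ℝ`-collinear complex numbers into `iℝ`. -/
theorem exists_common_phase {α β : ℂ} (hαβ : (β * conj α).im = 0) :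
    ∃ c : ℂ, c ≠ 0 ∧ (conj c * α).re = 0 ∧ (conj c * β).re = 0 := by
  by_cases hα : α = 0
  · by_cases hβ : β = 0
    · exact ⟨1, one_ne_zero, by simp [hα], by simp [hβ]⟩
    · refine ⟨Complex.I * β, mul_ne_zero Complex.I_ne_zero hβ, by simp [hα], ?_⟩
      simp; ring
  · refine ⟨Complex.I * α, mul_ne_zero Complex.I_ne_zero hα, ?_, ?_⟩
    · simp; ring
    · simp at hαβ ⊢; linarith

theorem exists_meridian_of_nondegenerate {h : Module.End ℂ V3} (hs : SelfAdj h)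
    (htr : LinearMap.trace ℂ V3 h = 0) (hdet : LinearMap.det h = 0) {x y : V3}
    (hx : herm x x ≠ 0) (hy : herm y y ≠ 0) (hxy : herm x y = 0)
    (kx : herm (h x) x = 0) (ky : herm (h y) y = 0)
    (kre : (herm (h x) y).re = 0) (kxy : herm (h x) y ≠ 0) :
    ∃ z : V3, IsRealPlane (Submodule.span ℝ {x, y, z}) ∧
      projR (Submodule.span ℝ {x, y, z}) ⊆ Bset h := by
  obtain ⟨p, hxp, hyp, hp⟩ := exists_polar hx hy hxy
  have hyx : herm y x = 0 := by rw [← herm_conj, hxy, map_zero]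
  have hpx : herm p x = 0 := by rw [← herm_conj, hxp, map_zero]
  have hpy : herm p y = 0 := by rw [← herm_conj, hyp, map_zero]
  obtain ⟨M, ex, ey, ep, et, ed⟩ := exists_matrix_of_linearIndependent (h := h)
    (linearIndependent_triple_of_orthogonal hx hy hp hxy hxp hyp)
  have cxy := hs.conj_herm x y
  have cxp := hs.conj_herm x p
  have cyp := hs.conj_herm y p
  have key (v : V3) : herm (h x) v = M 0 0 * herm x v + M 1 0 * herm y v + M 2 0 * herm p v ∧
      herm (h y) v = M 0 1 * herm x v + M 1 1 * herm y v + M 2 1 * herm p v ∧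
      herm (h p) v = M 0 2 * herm x v + M 1 2 * herm y v + M 2 2 * herm p v := by
    rw [ex, ey, ep]; simp [herm_add_left, herm_smul_left]
  obtain ⟨xx, yx, px⟩ := key x
  obtain ⟨xy, yy, py⟩ := key y
  obtain ⟨xp, yp, pp⟩ := key p
  simp only [hxy, hxp, hyp, hyx, hpx, hpy, mul_zero, add_zero, zero_add] at xx yx px xy yy py xp yp pp
  have m00 : M 0 0 = 0 := by simpa [kx, hx] using xx.symm
  have m11 : M 1 1 = 0 := by simpa [ky, hy] using yy.symm
  have m22 : M 2 2 = 0 := by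
    rw [htr, Matrix.trace_fin_three, m00, m11] at et
    simpa using et.symm
  have kp : herm (h p) p = 0 := by rw [pp, m22, zero_mul]
  have hd : herm (h x) y * herm (h y) p * herm (h p) x
      + herm (h y) x * herm (h x) p * herm (h p) y = 0 := by
    rw [hdet, Matrix.det_fin_three, m00, m11, m22] at ed
    rw [xy, yp, px, yx, xp, py]
    linear_combination (-herm x x * herm y y * herm p p) * ed
  rw [← cxy, ← cxp, ← cyp] at hd
  have him : (herm (h x) y).im ≠ 0 := fun h0 => kxy (Complex.ext kre h0)
  have hcol : (herm (h y) p * conj (herm (h x) p)).im = 0 := by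
    have := congrArg Complex.re hd
    simp [kre] at this ⊢
    apply mul_left_cancel₀ him
    linarith
  obtain ⟨c, hc, c1, c2⟩ := exists_common_phase hcol
  refine ⟨c • p, isRealPlane_span_and_subset hs
    (linearIndependent_triple_of_orthogonal hx hy ?_ hxy ?_ ?_) ?_ ?_ ?_ ?_ ?_ ?_ kre ?_ ?_⟩
  · rw [herm_smul_left, herm_smul_right]
    exact mul_ne_zero hc (mul_ne_zero (by simpa using hc) hp)
  · rw [herm_smul_right, hxp, mul_zero]
  · rw [herm_smul_right, hyp, mul_zero]
  · simp [hxy]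
  · simp [herm_smul_right, hxp]
  · simp [herm_smul_right, hyp]
  · simp [kx]
  · simp [ky]
  · rw [map_smul, herm_smul_left, herm_smul_right, kp]
    simp
  · rw [herm_smul_right, c1]
  · rw [herm_smul_right, c2]

theorem exists_meridian_of_degenerate {h : Module.End ℂ V3} (hs : SelfAdj h)
    (htr : LinearMap.trace ℂ V3 h = 0) (hdet : LinearMap.det h = 0) {n w : V3}
    (hn : n ≠ 0) (hnn : herm n n = 0) (hw : herm w w ≠ 0) (hnw : herm n w = 0)
    (kn : herm (h n) n = 0) (kw : herm (h w) w = 0)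
    (kre : (herm (h n) w).re = 0) (knw : herm (h n) w ≠ 0) :
    ∃ z : V3, IsRealPlane (Submodule.span ℝ {n, w, z}) ∧
      projR (Submodule.span ℝ {n, w, z}) ⊆ Bset h := by
  obtain ⟨m, hmm, hmw, hnm⟩ := exists_hyperbolic_partner hn hw hnn hnw
  have hwn : herm w n = 0 := by rw [← herm_conj, hnw, map_zero]
  have hwm : herm w m = 0 := by rw [← herm_conj, hmw, map_zero]
  have hmn : herm m n = 1 := by rw [← herm_conj, hnm, map_one]
  obtain ⟨M, en, ew, em, et, ed⟩ := exists_matrix_of_linearIndependent (h := h)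
    (linearIndependent_triple_of_hyperbolic hw hnn hmm hnw hmw hnm)
  have cnw := hs.conj_herm n w
  have cnm := hs.conj_herm n m
  have cwm := hs.conj_herm w m
  have key (v : V3) : herm (h n) v = M 0 0 * herm n v + M 1 0 * herm w v + M 2 0 * herm m v ∧
      herm (h w) v = M 0 1 * herm n v + M 1 1 * herm w v + M 2 1 * herm m v ∧
      herm (h m) v = M 0 2 * herm n v + M 1 2 * herm w v + M 2 2 * herm m v := by
    rw [en, ew, em]; simp [herm_add_left, herm_smul_left]
  obtain ⟨nn, wn, mn⟩ := key n
  obtain ⟨nw, ww, mw⟩ := key w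
  obtain ⟨nm, wm, mm⟩ := key m
  simp only [hnn, hnw, hnm, hwn, hwm, hmm, hmn, hmw, mul_zero, add_zero, zero_add, mul_one]
    at nn wn mn nw ww mw nm wm mm
  have m11 : M 1 1 = 0 := by simpa [kw, hw] using ww.symm
  have m20 : M 2 0 = 0 := by rw [← nn, kn]
  have hre : (herm (h n) m).re = 0 := by
    rw [htr, Matrix.trace_fin_three, m11, ← nm, ← mn, ← cnm] at et
    have := congrArg Complex.re et
    simp at this
    linarith
  have hd : herm (h n) m * (herm (h w) n * herm (h m) w) + herm (h n) w * (
      herm (h w) m * herm (h m) n - herm (h m) m * herm (h w) n) = 0 := by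
    rw [hdet, Matrix.det_fin_three, m11, m20] at ed
    rw [nm, wn, mw, nw, wm, mn, mm]
    linear_combination (herm w w) * ed
  rw [← cnw, ← cnm, ← cwm] at hd
  have him : (herm (h n) w).im ≠ 0 := fun h0 => knw (Complex.ext kre h0)
  have hq : (herm (h n) w).im * (herm (h m) m).re
      = 2 * (herm (h n) m).im * (herm (h w) m).re := by
    have := congrArg Complex.re hd
    simp [kre, hre] at this
    apply mul_left_cancel₀ him
    linarith
  set r := (herm (h n) w).im with hr
  set a : ℝ := (herm (h w) m).re / r with ha
  have har : a * r = (herm (h w) m).re := div_mul_cancel₀ _ him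
  have hqa : (herm (h m) m).re = 2 * a * (herm (h n) m).im := by
    apply mul_left_cancel₀ him
    rw [hq, ← har]; ring
  have wnre : (herm (h w) n).re = 0 := by rw [← cnw, Complex.conj_re, kre]
  have wnim : (herm (h w) n).im = -r := by rw [← cnw, Complex.conj_im]
  have mnre : (herm (h m) n).re = 0 := by rw [← cnm, Complex.conj_re, hre]
  have mnim : (herm (h m) n).im = -(herm (h n) m).im := by rw [← cnm, Complex.conj_im]
  have zz : herm (m + (Complex.I * a) • n) (m + (Complex.I * a) • n) = 0 := by
    simp [herm_add_left, herm_add_right, herm_smul_left, herm_smul_right, hnn, hmm, hnm, hmn]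
  have zw : herm (m + (Complex.I * a) • n) w = 0 := by
    simp [herm_add_left, herm_smul_left, hnw, hmw]
  have nz : herm n (m + (Complex.I * a) • n) = 1 := by
    simp [herm_add_right, herm_smul_right, hnn, hnm]
  refine ⟨m + (Complex.I * a) • n, isRealPlane_span_and_subset hs
    (linearIndependent_triple_of_hyperbolic hw hnn zz hnw zw nz) ?_ ?_ ?_ ?_ ?_ ?_ kre ?_ ?_⟩
  · simp [hnw]
  · simp [nz]
  · rw [herm_im_comm, zw]; simp
  · simp [kn]
  · simp [kw]
  · simp [herm_add_left, herm_add_right, herm_smul_left, herm_smul_right, kn, mnim, hqa]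
    ring
  · simp [herm_add_right, herm_smul_right, kn, hre]
  · simp [herm_add_right, herm_smul_right, wnim, ← har]

/-- A geodesic is spanned by an orthogonal pair containing a non-null vector. -/
theorem IsGeodesic.exists_orthogonal_pair {W₀ : Submodule ℝ V3} (hg : IsGeodesic W₀) :
    ∃ x y : V3, x ≠ 0 ∧ herm y y ≠ 0 ∧ herm x y = 0 ∧ W₀ = Submodule.span ℝ {x, y} := by
  obtain ⟨hf, him, w, hw, w', hw', hne⟩ := hg
  obtain ⟨y, hyW, hy⟩ : ∃ y ∈ W₀, herm y y ≠ 0 := by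
    by_contra! hall
    have e := hall (w + w') (W₀.add_mem hw hw')
    rw [herm_add_left, herm_add_right, herm_add_right, hall w hw, hall w' hw'] at e
    have hc : herm w' w = herm w w' := by
      rw [← herm_conj]; exact Complex.conj_eq_iff_im.mpr (him w hw w' hw')
    rw [hc] at e
    apply hne
    linear_combination e / 2
  obtain ⟨v, hvW, hv⟩ : ∃ v ∈ W₀, v ∉ Submodule.span ℝ {y} := by
    by_contra! hall
    have h1 := Submodule.finrank_mono (show W₀ ≤ Submodule.span ℝ {y} from hall)
    have h2 := finrank_span_le_card (R := ℝ) ({y} : Set V3)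
    simp at h2
    omega
  set a : ℝ := -((herm v y).re / (herm y y).re) with ha
  have hy' : (herm y y).re ≠ 0 := fun h0 => hy (Complex.ext h0 (herm_self_im y))
  have hxW : v + a • y ∈ W₀ := W₀.add_mem hvW (W₀.smul_mem a hyW)
  have hxy : herm (v + a • y) y = 0 := by
    refine Complex.ext ?_ (him _ hxW _ hyW)
    rw [real_smul_eq_coe_smul, herm_add_left, herm_smul_left]
    simp [ha]
    field_simp; ring
  have hx : v + a • y ∉ Submodule.span ℝ {y} := fun hm =>
    hv ((Submodule.add_mem_iff_left _
      (Submodule.smul_mem _ a (Submodule.mem_span_singleton_self y))).mp hm)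
  refine ⟨v + a • y, y, fun h0 => hx (h0 ▸ Submodule.zero_mem _), hy, hxy, ?_⟩
  have hle : Submodule.span ℝ {v + a • y, y} ≤ W₀ := by
    rw [Submodule.span_le]
    rintro _ (rfl | rfl) <;> assumption
  have hy0 : y ≠ 0 := by rintro rfl; exact hy (herm_zero_left 0)
  have hli : LinearIndependent ℝ ![y, v + a • y] := by
    rw [LinearIndependent.pair_iff' hy0]
    intro c hc
    exact hx (Submodule.mem_span_singleton.mpr ⟨c, hc⟩)
  refine (Submodule.eq_of_le_of_finrank_eq hle ?_).symm
  have := finrank_span_eq_card hli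
  rw [Matrix.range_cons_cons_empty, Set.pair_comm, Fintype.card_fin] at this
  exact this.trans hf.symm

theorem linearIndependent_pair_of_herm {x y : V3} (hx : x ≠ 0) (hy : herm y y ≠ 0)
    (hxy : herm x y = 0) : LinearIndependent ℂ ![x, y] := by
  rw [LinearIndependent.pair_iff' hx]
  rintro c rfl
  apply hy
  rw [herm_smul_left, hxy, mul_zero]

/-- Lemma 2.9: any geodesic contained in a bisector is contained in a
slice or in a meridian of the bisector. -/
theorem stmt_12 (h : Module.End ℂ V3) (hb : IsBisector h)
    (W₀ : Submodule ℝ V3) (hg : IsGeodesic W₀) (hsub : projR W₀ ⊆ Bset h) :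
    (∃ U : Submodule ℂ V3, Module.finrank ℂ U = 2 ∧ projR W₀ ⊆ projC U ∧
        projC U ⊆ Bset h) ∨
      (∃ T : Submodule ℝ V3, IsRealPlane T ∧ projR W₀ ⊆ projR T ∧
        projR T ⊆ Bset h) := by
  obtain ⟨hs, htr, hrk, -⟩ := hb
  have hdet := det_eq_zero_of_finrank_range hrk
  obtain ⟨x, y, hx, hy, hxy, rfl⟩ := hg.exists_orthogonal_pair
  have hq (v : V3) (hv : v ∈ Submodule.span ℝ {x, y}) : herm (h v) v = 0 := by
    by_cases hv0 : v = 0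
    · rw [hv0, map_zero, herm_zero_left]
    · exact herm_eq_zero_of_mem_Bset hv0 (hsub ⟨v, hv0, hv, rfl⟩)
  have hxm : x ∈ Submodule.span ℝ {x, y} := Submodule.subset_span (by simp)
  have hym : y ∈ Submodule.span ℝ {x, y} := Submodule.subset_span (by simp)
  have kx := hq x hxm
  have ky := hq y hym
  have kre : (herm (h x) y).re = 0 := by
    have e := congrArg Complex.re (hq (x + y) (Submodule.add_mem _ hxm hym))
    simp [herm_add_left, herm_add_right, kx, ky, hs.re_comm y x] at e
    exact e
  by_cases kxy : herm (h x) y = 0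
  · refine Or.inl ⟨Submodule.span ℂ {x, y}, ?_, ?_, projC_span_pair_subset hs kx ky kxy⟩
    · have := finrank_span_eq_card (linearIndependent_pair_of_herm hx hy hxy)
      rwa [Matrix.range_cons_cons_empty, Fintype.card_fin] at this
    · rintro _ ⟨v, hv0, hv, rfl⟩
      exact ⟨v, hv0, Submodule.span_le_restrictScalars ℝ ℂ _ hv, rfl⟩
  · obtain ⟨z, hz, hzB⟩ : ∃ z : V3, IsRealPlane (Submodule.span ℝ {x, y, z}) ∧
        projR (Submodule.span ℝ {x, y, z}) ⊆ Bset h := by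
      by_cases hxx : herm x x = 0
      · exact exists_meridian_of_degenerate hs htr hdet hx hxx hy hxy kx ky kre kxy
      · exact exists_meridian_of_nondegenerate hs htr hdet hxx hy hxy kx ky kre kxy
    refine Or.inr ⟨_, hz, ?_, hzB⟩
    rintro _ ⟨v, hv0, hv, rfl⟩
    refine ⟨v, hv0, Submodule.span_mono ?_ hv, rfl⟩
    rintro _ (rfl | rfl) <;> simp

end
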